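/- Let d ∈ {3,4} and let P be the law of a random traps environment ρ = (ρ_x)_{x∈ℤ^d} which is stationary under the shifts of ℤ^d, satisfies E[π_ρ(0)] < ∞ where π_ρ(x) = (1−ρ_x)^{-1}, and satisfies: there exist R₀, K₀ > 0 such that E[π_ρ(x)π_ρ(y)] ≤ K₀ whenever |x−y| > R₀. Then for every R > 0 there exists c > 0 such that for all m ≥ 2: E[ ∑_{x,y∈Λ_m} g(0,x)² g(x,y) g(0,y) π_ρ(x) π_ρ(y) · 1_{π_ρ(x) ≤ R·max(|x|,1)²} · 1_{π_ρ(y) ≤ R·max(|y|,1)²} ] ≤ c·m² if d = 3, and ≤ c·(log m)² if d = 4, where g is the Green's function of the simple random walk on ℤ^d. -/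

import Mathlib

open MeasureTheory
open scoped ENNReal NNReal Classical

noncomputable section

/-- The lattice `ℤ^d`. -/
abbrev Zd (d : ℕ) := Fin d → ℤ

/-- Euclidean norm of a lattice point. -/
def znorm {d : ℕ} (x : Zd d) : ℝ := Real.sqrt (∑ i, ((x i : ℝ)) ^ 2)

/-- Matrix powers of a (sub-)stochastic kernel on `ℤ^d`, valued in `[0,∞]`. -/
def kpow {d : ℕ} (p : Zd d → Zd d → ℝ≥0∞) : ℕ → Zd d → Zd d → ℝ≥0∞
  | 0 => fun x y => if x = y then 1 else 0
  | n + 1 => fun x y => ∑' z : Zd d, kpow p n x z * p z y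

/-- Transition kernel of the simple random walk on `ℤ^d`. -/
def srwK (d : ℕ) (x y : Zd d) : ℝ≥0∞ :=
  if znorm (x - y) = 1 then (2 * (d : ℝ≥0∞))⁻¹ else 0

/-- Green's function of the simple random walk on `ℤ^d`. -/
def gSRW (d : ℕ) (x y : Zd d) : ℝ≥0∞ := ∑' n : ℕ, kpow (srwK d) n x y

/-- The box `Λ_m = ℤ^d ∩ [-m,m]^d`. -/
def lamF (d m : ℕ) : Finset (Zd d) := Fintype.piFinset fun _ => Finset.Icc (-(m : ℤ)) (m : ℤ)

/-- `π_ρ(x) = (1-ρ_x)⁻¹`, as an extended real. -/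
def piT {d : ℕ} (ρ : Zd d → ℝ) (x : Zd d) : ℝ≥0∞ := ENNReal.ofReal ((1 - ρ x)⁻¹)

/-- Indicator of the event `π_ρ(x) ≤ R·max(|x|,1)²`. -/
def smallTrap {d : ℕ} (R : ℝ) (ρ : Zd d → ℝ) (x : Zd d) : ℝ≥0∞ :=
  if (1 - ρ x)⁻¹ ≤ R * max (znorm x) 1 ^ 2 then 1 else 0

lemma exists_eq_single_of_znorm_eq_one {d : ℕ} {w : Zd d} (h : znorm w = 1) :
    ∃ i, w = Pi.single i 1 ∨ w = -Pi.single i 1 := by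
  have h1 : ∑ i, (w i) ^ 2 = 1 := by
    have h2 : ∑ i, ((w i : ℝ)) ^ 2 = 1 := by
      unfold znorm at h
      exact Real.sqrt_eq_one.mp h
    exact_mod_cast h2
  have hne : ∃ i, w i ≠ 0 := by
    by_contra! hcon
    simp [hcon] at h1
  obtain ⟨i, hi⟩ := hne
  have hi1 : 1 ≤ w i ^ 2 := by
    have : 0 < w i ^ 2 := by positivity
    omega
  rw [← Finset.add_sum_erase _ _ (Finset.mem_univ i)] at h1
  have hnn : ∀ j ∈ Finset.univ.erase i, 0 ≤ w j ^ 2 := fun j _ => sq_nonneg _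
  have hrest : ∑ j ∈ Finset.univ.erase i, w j ^ 2 = 0 :=
    le_antisymm (by linarith) (Finset.sum_nonneg hnn)
  rw [Finset.sum_eq_zero_iff_of_nonneg hnn] at hrest
  have hoff : ∀ j, j ≠ i → w j = 0 := fun j hj => by
    have := hrest j (by simp [hj])
    exact pow_eq_zero_iff (two_ne_zero) |>.mp this
  have hsq : w i ^ 2 = 1 := by
    have := Finset.sum_nonneg hnn
    linarith
  refine ⟨i, ?_⟩
  rcases mul_self_eq_one_iff.mp ((sq (w i)).symm.trans hsq) with h' | h'
  · left
    ext j
    by_cases hj : j = i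
    · subst hj; simp [h']
    · simp [hj, hoff j hj]
  · right
    ext j
    by_cases hj : j = i
    · subst hj; simp [h']
    · simp [hj, hoff j hj]

lemma srwK_le {d : ℕ} (z y : Zd d) :
    srwK d z y ≤ ∑ i : Fin d, ((if z = y + Pi.single i 1 then (2 * (d : ℝ≥0∞))⁻¹ else 0) +
      (if z = y - Pi.single i 1 then (2 * (d : ℝ≥0∞))⁻¹ else 0)) := by
  unfold srwK
  split_ifs with h
  · obtain ⟨i, hi⟩ := exists_eq_single_of_znorm_eq_one h
    refine le_trans ?_ (Finset.single_le_sum (fun _ _ => zero_le) (Finset.mem_univ i))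
    rcases hi with hi | hi
    · rw [if_pos (by rw [← hi]; abel)]
      exact le_self_add
    · rw [if_pos (by rw [sub_eq_add_neg, ← hi]; abel : z = y - Pi.single i 1)]
      exact le_add_self
  · exact zero_le

lemma tsum_mul_srwK_le {d : ℕ} (h : Zd d → ℝ≥0∞) (y : Zd d) :
    ∑' z, h z * srwK d z y ≤
      ∑ i : Fin d, (h (y + Pi.single i 1) + h (y - Pi.single i 1)) * (2 * (d : ℝ≥0∞))⁻¹ := by
  calc ∑' z, h z * srwK d z y
      ≤ ∑' z, ∑ i : Fin d, ((if z = y + Pi.single i 1 then h z * (2 * (d : ℝ≥0∞))⁻¹ else 0) +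
          (if z = y - Pi.single i 1 then h z * (2 * (d : ℝ≥0∞))⁻¹ else 0)) := by
        refine ENNReal.tsum_le_tsum fun z => ?_
        refine (mul_le_mul_right (srwK_le z y) _).trans_eq ?_
        simp only [Finset.mul_sum, mul_add, mul_ite, mul_zero]
    _ = _ := by
        rw [Summable.tsum_finsetSum fun i _ => ENNReal.summable]
        refine Finset.sum_congr rfl fun i _ => ?_
        rw [ENNReal.tsum_add, tsum_ite_eq, tsum_ite_eq, add_mul]

/-- A nonnegative function that is superharmonic for the simple random walk, strictly at the
origin, dominates a multiple of the Green's function. -/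
lemma gSRW_le_of_superharmonic {d : ℕ} {f : Zd d → ℝ} {ε : ℝ} (hd : 0 < d)
    (hf : ∀ x, 0 ≤ f x) (hε : 0 < ε)
    (hsup : ∀ y, (if y = 0 then ε else 0) +
      (∑ i, (f (y + Pi.single i 1) + f (y - Pi.single i 1))) * (2 * (d : ℝ))⁻¹ ≤ f y)
    (x y : Zd d) : gSRW d x y ≤ ENNReal.ofReal (f (y - x) / ε) := by
  have hdc : (2 * (d : ℝ≥0∞))⁻¹ = ENNReal.ofReal (2 * (d : ℝ))⁻¹ := by
    rw [ENNReal.ofReal_inv_of_pos (by positivity), ENNReal.ofReal_mul (by norm_num)]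
    simp
  have key : ∀ N y, ∑ n ∈ Finset.range N, kpow (srwK d) n x y ≤
      ENNReal.ofReal (f (y - x) / ε) := by
    intro N
    induction N with
    | zero => intro y; simp
    | succ N ih =>
      intro y
      rw [Finset.sum_range_succ']
      have h1 : ∑ n ∈ Finset.range N, kpow (srwK d) (n + 1) x y =
          ∑' z, (∑ n ∈ Finset.range N, kpow (srwK d) n x z) * srwK d z y := by
        simp only [kpow, Finset.sum_mul]
        rw [Summable.tsum_finsetSum fun i _ => ENNReal.summable]
      rw [h1]
      have h2 : ∑' z, (∑ n ∈ Finset.range N, kpow (srwK d) n x z) * srwK d z y ≤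
          ENNReal.ofReal ((∑ i, (f (y - x + Pi.single i 1) + f (y - x - Pi.single i 1))) *
            (2 * (d : ℝ))⁻¹ / ε) := by
        refine (ENNReal.tsum_le_tsum fun z => mul_le_mul_left (ih z) _).trans ?_
        refine (tsum_mul_srwK_le (fun z => ENNReal.ofReal (f (z - x) / ε)) y).trans_eq ?_
        rw [hdc, mul_div_right_comm, ENNReal.ofReal_mul, Finset.sum_div, ← Finset.sum_mul,
          ENNReal.ofReal_sum_of_nonneg]
        · congr 1
          refine Finset.sum_congr rfl fun i _ => ?_
          rw [← ENNReal.ofReal_add (div_nonneg (hf _) hε.le) (div_nonneg (hf _) hε.le), ← add_div]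
          congr 4 <;> abel
        · exact fun i _ => div_nonneg (add_nonneg (hf _) (hf _)) hε.le
        · exact div_nonneg (Finset.sum_nonneg fun i _ => add_nonneg (hf _) (hf _)) hε.le
      have h3 : kpow (srwK d) 0 x y = ENNReal.ofReal ((if y - x = 0 then ε else 0) / ε) := by
        simp only [kpow, sub_eq_zero, eq_comm (a := x)]
        split_ifs
        · simp [hε.ne']
        · simp
      rw [h3]
      refine (add_le_add_left h2 _).trans ?_
      rw [← ENNReal.ofReal_add]
      · refine ENNReal.ofReal_le_ofReal ?_
        rw [← add_div]
        have := hsup (y - x)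
        gcongr
        linarith
      · exact div_nonneg (mul_nonneg (Finset.sum_nonneg fun i _ => add_nonneg (hf _) (hf _))
          (by positivity)) hε.le
      · split_ifs <;> positivity
  unfold gSRW
  rw [ENNReal.tsum_eq_iSup_nat]
  exact iSup_le fun N => key N y

/-- The regularised squared Euclidean norm `|x|² + 8`. -/
def regSq {d : ℕ} (x : Zd d) : ℝ := ∑ i, (x i : ℝ) ^ 2 + 8

lemma eight_le_regSq {d : ℕ} (x : Zd d) : 8 ≤ regSq x := by
  have : 0 ≤ ∑ i, (x i : ℝ) ^ 2 := Finset.sum_nonneg fun _ _ => sq_nonneg _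
  unfold regSq
  linarith

lemma regSq_pos {d : ℕ} (x : Zd d) : 0 < regSq x := by
  linarith [eight_le_regSq x]

lemma regSq_add_single_int {d : ℕ} (x : Zd d) (i : Fin d) (s : ℤ) :
    regSq (x + Pi.single i s) = regSq x + 2 * s * x i + s ^ 2 := by
  unfold regSq
  rw [← Finset.add_sum_erase _ _ (Finset.mem_univ i),
    ← Finset.add_sum_erase _ (fun j => (x j : ℝ) ^ 2) (Finset.mem_univ i)]
  have : ∑ j ∈ Finset.univ.erase i, (((x + Pi.single i s : Zd d) j : ℤ) : ℝ) ^ 2 =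
      ∑ j ∈ Finset.univ.erase i, (x j : ℝ) ^ 2 := by
    refine Finset.sum_congr rfl fun j hj => ?_
    have : j ≠ i := Finset.ne_of_mem_erase hj
    simp [this]
  rw [this]
  simp
  ring

lemma regSq_add_single {d : ℕ} (x : Zd d) (i : Fin d) :
    regSq (x + Pi.single i 1) = regSq x + 1 + 2 * x i := by
  rw [regSq_add_single_int]; push_cast; ring

lemma regSq_sub_single {d : ℕ} (x : Zd d) (i : Fin d) :
    regSq (x - Pi.single i 1) = regSq x + 1 - 2 * x i := by
  rw [sub_eq_add_neg, ← Pi.single_neg, regSq_add_single_int]; push_cast; ring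

lemma regSq_zero {d : ℕ} : regSq (0 : Zd d) = 8 := by simp [regSq]

lemma four_mul_sq_le {B t : ℝ} (hB : t ^ 2 + 9 ≤ B) : 4 * t ^ 2 / B ^ 2 ≤ 1 / 9 := by
  have : 0 < B := by nlinarith
  rw [div_le_div_iff₀ (by positivity) (by norm_num)]
  nlinarith [sq_nonneg (t ^ 2 - 9)]

lemma inv_add_inv_le {B t : ℝ} (hB : t ^ 2 + 9 ≤ B) :
    (B + 2 * t)⁻¹ + (B - 2 * t)⁻¹ ≤
      B⁻¹ * (2 + 2 * (4 * t ^ 2 / B ^ 2) + 4 * (4 * t ^ 2 / B ^ 2) ^ 2) := by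
  have hB0 : 0 < B := by nlinarith
  have h1 : 0 < B + 2 * t := by nlinarith [sq_nonneg (t + 1)]
  have h2 : 0 < B - 2 * t := by nlinarith [sq_nonneg (t - 1)]
  set v := 4 * t ^ 2 / B ^ 2 with hv
  have hv1 : v ≤ 1 / 9 := four_mul_sq_le hB
  have hv0 : 0 ≤ v := by positivity
  have h3 : (B + 2 * t)⁻¹ + (B - 2 * t)⁻¹ = B⁻¹ * (2 / (1 - v)) := by
    have : 1 - v = (B + 2 * t) * (B - 2 * t) / B ^ 2 := by
      rw [hv]; field_simp; ring
    rw [this]; field_simp; ring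
  rw [h3]
  gcongr
  rw [div_le_iff₀ (by linarith)]
  nlinarith [mul_nonneg hv0 hv0, mul_nonneg (mul_nonneg hv0 hv0) (by linarith : 0 ≤ 1 / 9 - v)]

lemma inv_sqrt_add_inv_sqrt_le {B t : ℝ} (hB : t ^ 2 + 9 ≤ B) :
    (√(B + 2 * t))⁻¹ + (√(B - 2 * t))⁻¹ ≤
      (√B)⁻¹ * (2 + 3 / 4 * (4 * t ^ 2 / B ^ 2) + 3 / 2 * (4 * t ^ 2 / B ^ 2) ^ 2) := by
  have hB0 : 0 < B := by nlinarith
  have h1 : 0 < B + 2 * t := by nlinarith [sq_nonneg (t + 1)]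
  have h2 : 0 < B - 2 * t := by nlinarith [sq_nonneg (t - 1)]
  set v := 4 * t ^ 2 / B ^ 2 with hv
  have hv1 : v ≤ 1 / 9 := four_mul_sq_le hB
  have hv0 : 0 ≤ v := by positivity
  have hw : 0 < 1 - v := by linarith
  have hvw : 1 - v = (B + 2 * t) * (B - 2 * t) / B ^ 2 := by
    rw [hv]; field_simp; ring
  have hroot : (√(1 - v))⁻¹ ≤ 1 + v / 2 + v ^ 2 := by
    have h5 : 0 < 1 + v / 2 + v ^ 2 := by positivity
    rw [inv_le_comm₀ (Real.sqrt_pos.mpr hw) h5]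
    apply Real.le_sqrt_of_sq_le
    rw [inv_pow, inv_le_comm₀ (by positivity) hw, inv_le_iff_one_le_mul₀ hw]
    have := pow_nonneg hv0 2
    have := pow_nonneg hv0 3
    have := pow_nonneg hv0 4
    nlinarith [mul_nonneg (pow_nonneg hv0 2) (by linarith : 0 ≤ 1 / 9 - v),
      mul_nonneg (pow_nonneg hv0 3) (by linarith : 0 ≤ 1 / 9 - v),
      mul_nonneg (pow_nonneg hv0 4) (by linarith : 0 ≤ 1 / 9 - v)]
  have hinv : (1 - v)⁻¹ ≤ 1 + v + 2 * v ^ 2 := by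
    rw [inv_le_iff_one_le_mul₀ hw]
    nlinarith [mul_nonneg (pow_nonneg hv0 2) (by linarith : 0 ≤ 1 / 9 - v)]
  have hs : √(1 - v) = √(B + 2 * t) * √(B - 2 * t) / B := by
    rw [hvw, Real.sqrt_div (by positivity), Real.sqrt_mul h1.le, Real.sqrt_sq hB0.le]
  have ha := Real.sqrt_pos.mpr h1
  have hb := Real.sqrt_pos.mpr h2
  have hc := Real.sqrt_pos.mpr hB0
  have ha2 := Real.sq_sqrt h1.le
  have hb2 := Real.sq_sqrt h2.le
  have hc2 := Real.sq_sqrt hB0.le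
  refine (sq_le_sq₀ (by positivity) (by positivity)).mp ?_
  have h6 : ((√(B + 2 * t))⁻¹ + (√(B - 2 * t))⁻¹) ^ 2 =
      B⁻¹ * (2 * (1 - v)⁻¹ + 2 * (√(1 - v))⁻¹) := by
    have hab : √(B + 2 * t) ^ 2 + √(B - 2 * t) ^ 2 = 2 * B := by rw [ha2, hb2]; ring
    rw [hs, hvw]
    generalize √(B + 2 * t) = a at *
    generalize √(B - 2 * t) = b at *
    rw [← ha2, ← hb2]
    field_simp
    linear_combination hab
  rw [h6, mul_pow, inv_pow, hc2]
  gcongr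
  nlinarith [pow_nonneg hv0 3, pow_nonneg hv0 4, pow_nonneg hv0 2]

lemma sq_add_nine_le {d : ℕ} (y : Zd d) (i : Fin d) : (y i : ℝ) ^ 2 + 9 ≤ regSq y + 1 := by
  have := Finset.single_le_sum (f := fun i => (y i : ℝ) ^ 2) (fun _ _ => sq_nonneg _)
    (Finset.mem_univ i)
  simp only [regSq]
  linarith

lemma sum_four_mul_sq_div {d : ℕ} (y : Zd d) (B : ℝ) :
    ∑ i, 4 * (y i : ℝ) ^ 2 / B ^ 2 = 4 * (regSq y - 8) / B ^ 2 := by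
  simp only [regSq, ← Finset.sum_div, ← Finset.mul_sum]
  ring

lemma sum_four_mul_sq_div_sq_le {d : ℕ} (y : Zd d) :
    ∑ i, (4 * (y i : ℝ) ^ 2 / (regSq y + 1) ^ 2) ^ 2 ≤ 16 / (regSq y + 1) ^ 2 := by
  have hB : 0 < regSq y + 1 := by linarith [regSq_pos y]
  calc ∑ i, (4 * (y i : ℝ) ^ 2 / (regSq y + 1) ^ 2) ^ 2
      ≤ ∑ i, 4 * (y i : ℝ) ^ 2 / (regSq y + 1) ^ 2 * (4 / (regSq y + 1)) := by
        refine Finset.sum_le_sum fun i _ => ?_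
        rw [sq (4 * (y i : ℝ) ^ 2 / (regSq y + 1) ^ 2)]
        gcongr ?_ * ?_
        rw [div_le_div_iff₀ (by positivity) (by positivity)]
        nlinarith [sq_add_nine_le y i]
    _ ≤ 16 / (regSq y + 1) ^ 2 := by
        rw [← Finset.sum_mul, sum_four_mul_sq_div, div_mul_div_comm,
          div_le_div_iff₀ (by positivity) (by positivity)]
        have : 0 < (regSq y + 1) ^ 2 := by positivity
        nlinarith

lemma sum_quadratic_le {d : ℕ} (y : Zd d) (a b : ℝ) {c : ℝ} (hc : 0 ≤ c) :
    ∑ i, (a + b * (4 * (y i : ℝ) ^ 2 / (regSq y + 1) ^ 2) +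
      c * (4 * (y i : ℝ) ^ 2 / (regSq y + 1) ^ 2) ^ 2) ≤
    d * a + b * (4 * (regSq y - 8) / (regSq y + 1) ^ 2) + c * (16 / (regSq y + 1) ^ 2) := by
  rw [Finset.sum_add_distrib, Finset.sum_add_distrib, ← Finset.mul_sum, ← Finset.mul_sum,
    sum_four_mul_sq_div]
  have := mul_le_mul_of_nonneg_left (sum_four_mul_sq_div_sq_le y) hc
  simp only [Finset.sum_const, Finset.card_univ, Fintype.card_fin, nsmul_eq_mul]
  linarith

lemma gSRW_four_le (x y : Zd 4) : gSRW 4 x y ≤ ENNReal.ofReal (72 * (regSq (y - x))⁻¹) := by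
  have h := gSRW_le_of_superharmonic (d := 4) (f := fun x => (regSq x)⁻¹) (ε := 1 / 72)
    (by norm_num) (fun x => (inv_pos.mpr (regSq_pos x)).le) (by norm_num) ?_ x y
  · refine h.trans_eq ?_
    congr 1
    ring
  intro y
  simp only [regSq_add_single, regSq_sub_single]
  split_ifs with hy
  · subst hy
    norm_num [regSq_zero]
  have hA := eight_le_regSq y
  have hsum := Finset.sum_le_sum fun i (_ : i ∈ Finset.univ) => inv_add_inv_le (sq_add_nine_le y i)
  rw [← Finset.mul_sum] at hsum
  have h2 := sum_quadratic_le y 2 2 (c := 4) (by norm_num)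
  set A := regSq y
  have hB : (0 : ℝ) < (A + 1)⁻¹ := by positivity
  refine (add_le_add_right (mul_le_mul_of_nonneg_right (hsum.trans
    (mul_le_mul_of_nonneg_left h2 hB.le)) (by norm_num)) _).trans ?_
  simp only [Nat.cast_ofNat]
  rw [← sub_nonneg]
  have : A⁻¹ - (0 + (A + 1)⁻¹ * (4 * 2 + 2 * (4 * (A - 8) / (A + 1) ^ 2) +
      4 * (16 / (A + 1) ^ 2)) * (2 * 4)⁻¹) = (2 * A + 1) / (A * (A + 1) ^ 3) := by
    field_simp
    ring
  rw [this]
  positivity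

lemma gSRW_three_le (x y : Zd 3) :
    gSRW 3 x y ≤ ENNReal.ofReal (72 * (√(regSq (y - x)))⁻¹) := by
  have h := gSRW_le_of_superharmonic (d := 3) (f := fun x => (√(regSq x))⁻¹) (ε := 1 / 72)
    (by norm_num) (fun x => by positivity) (by norm_num) ?_ x y
  · refine h.trans_eq ?_
    congr 1
    ring
  intro y
  simp only [regSq_add_single, regSq_sub_single]
  split_ifs with hy
  · subst hy
    have h8 : √8 ≤ 72 / 25 := by
      rw [Real.sqrt_le_left (by norm_num)]
      norm_num
    have h9 : √(9 : ℝ) = 3 := by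
      rw [show (9 : ℝ) = 3 ^ 2 by norm_num]
      exact Real.sqrt_sq (by norm_num)
    have : (25 : ℝ) / 72 ≤ (√8)⁻¹ := by
      rw [le_inv_comm₀ (by norm_num) (by positivity)]
      norm_num at h8 ⊢
      exact h8
    norm_num [regSq_zero, h9]
    linarith
  have hA := eight_le_regSq y
  have hsum := Finset.sum_le_sum fun i (_ : i ∈ Finset.univ) =>
    inv_sqrt_add_inv_sqrt_le (sq_add_nine_le y i)
  rw [← Finset.mul_sum] at hsum
  have h2 := sum_quadratic_le y 2 (3 / 4) (c := 3 / 2) (by norm_num)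
  set A := regSq y
  have hB : (0 : ℝ) < (√(A + 1))⁻¹ := by positivity
  refine (add_le_add_right (mul_le_mul_of_nonneg_right (hsum.trans
    (mul_le_mul_of_nonneg_left h2 hB.le)) (by norm_num)) _).trans ?_
  simp only [Nat.cast_ofNat]
  have h3 : (3 * 2 + 3 / 4 * (4 * (A - 8) / (A + 1) ^ 2) + 3 / 2 * (16 / (A + 1) ^ 2)) *
      (2 * 3)⁻¹ = 1 + A / (2 * (A + 1) ^ 2) := by
    field_simp
    ring
  rw [mul_assoc, h3, zero_add, inv_mul_le_iff₀ (by positivity), ← div_eq_mul_inv,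
    ← Real.sqrt_div (by positivity)]
  apply Real.le_sqrt_of_sq_le
  rw [← sub_nonneg]
  have : (A + 1) / A - (1 + A / (2 * (A + 1) ^ 2)) ^ 2 =
      (8 * A ^ 3 + 4 * (A + 1) ^ 4 - 4 * A ^ 4 - 8 * A ^ 3 -
        (4 * A ^ 2 * (A + 1) ^ 2 - 4 * A ^ 4) - A ^ 3) / (4 * A * (A + 1) ^ 4) := by
    field_simp
    ring
  rw [this]
  apply div_nonneg _ (by positivity)
  have : 0 < A := by linarith
  ring_nf
  nlinarith [pow_pos this 3, pow_pos this 4]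

lemma mem_lamF {d m : ℕ} {x : Zd d} : x ∈ lamF d m ↔ ∀ i, |x i| ≤ m := by
  simp [lamF, abs_le]

lemma card_lamF (d m : ℕ) : (lamF d m).card = (2 * m + 1) ^ d := by
  have : ((m : ℤ) + 1 + m).toNat = 2 * m + 1 := by omega
  simp [lamF, this]

lemma lamF_zero (d : ℕ) : lamF d 0 = {0} := by
  ext x
  simp [mem_lamF, funext_iff]

lemma lamF_mono {d m n : ℕ} (h : m ≤ n) : lamF d m ⊆ lamF d n := fun x hx => by
  rw [mem_lamF] at *
  exact fun i => (hx i).trans (by exact_mod_cast h)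

/-- Splitting off one spherical shell. -/
lemma sum_lamF_succ_le {d : ℕ} {φ : ℝ → ℝ} (hφ : AntitoneOn φ (Set.Ioi 0)) (m : ℕ) :
    ∑ x ∈ lamF d (m + 1), φ (regSq x) ≤ ∑ x ∈ lamF d m, φ (regSq x) +
      ((2 * (m : ℝ) + 3) ^ d - (2 * (m : ℝ) + 1) ^ d) * φ (((m : ℝ) + 1) ^ 2) := by
  rw [← Finset.sum_sdiff (lamF_mono (d := d) (Nat.le_succ m)), add_comm]
  gcongr
  have hcard : ((lamF d (m + 1) \ lamF d m).card : ℝ) =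
      (2 * (m : ℝ) + 3) ^ d - (2 * (m : ℝ) + 1) ^ d := by
    rw [Finset.cast_card_sdiff (lamF_mono (Nat.le_succ m)), card_lamF, card_lamF]
    push_cast
    ring
  rw [← hcard, ← nsmul_eq_mul]
  refine Finset.sum_le_card_nsmul _ _ _ fun x hx => ?_
  obtain ⟨-, hx⟩ := Finset.mem_sdiff.mp hx
  rw [mem_lamF] at hx
  push Not at hx
  obtain ⟨i, hi⟩ := hx
  refine hφ (by simp; positivity) (regSq_pos x) ?_
  have h1 : (m : ℝ) + 1 ≤ |(x i : ℝ)| := by exact_mod_cast hi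
  have h2 := pow_le_pow_left₀ (by positivity) h1 2
  rw [sq_abs] at h2
  linarith [sq_add_nine_le x i]

lemma sum_lamF_three_inv_le (m : ℕ) : ∑ x ∈ lamF 3 m, (regSq x)⁻¹ ≤ 1 + 26 * m := by
  induction m with
  | zero => norm_num [lamF_zero, regSq_zero]
  | succ m ih =>
    have := sum_lamF_succ_le (d := 3) (φ := fun t => t⁻¹)
      (fun a ha b _ hab => inv_anti₀ ha hab) m
    refine this.trans ?_
    have h : ((2 * (m : ℝ) + 3) ^ 3 - (2 * (m : ℝ) + 1) ^ 3) * (((m : ℝ) + 1) ^ 2)⁻¹ ≤ 26 := by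
      rw [← div_eq_mul_inv, div_le_iff₀ (by positivity)]
      have : (0 : ℝ) ≤ m := by positivity
      nlinarith
    push_cast
    linarith

lemma sum_lamF_four_inv_sq_le (m : ℕ) :
    ∑ x ∈ lamF 4 m, ((regSq x) ^ 2)⁻¹ ≤ 1 + 80 * (harmonic m : ℝ) := by
  induction m with
  | zero => norm_num [lamF_zero, regSq_zero]
  | succ m ih =>
    have := sum_lamF_succ_le (d := 4) (φ := fun t => (t ^ 2)⁻¹)
      (fun a ha b _ hab => inv_anti₀ (pow_pos ha 2) (pow_le_pow_left₀ ha.le hab 2)) m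
    refine this.trans ?_
    have h : ((2 * (m : ℝ) + 3) ^ 4 - (2 * (m : ℝ) + 1) ^ 4) * ((((m : ℝ) + 1) ^ 2) ^ 2)⁻¹ ≤
        80 * ((m : ℝ) + 1)⁻¹ := by
      rw [← div_eq_mul_inv, ← div_eq_mul_inv, div_le_div_iff₀ (by positivity) (by positivity)]
      have : (0 : ℝ) ≤ m := by positivity
      have h2 : (2 * (m : ℝ) + 3) ^ 4 - (2 * (m : ℝ) + 1) ^ 4 ≤ 80 * ((m : ℝ) + 1) ^ 3 := by
        nlinarith [pow_nonneg this 2, pow_nonneg this 3]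
      calc _ ≤ 80 * ((m : ℝ) + 1) ^ 3 * (m + 1) := by gcongr
        _ = _ := by ring
    rw [harmonic_succ]
    push_cast
    linarith

lemma sum_lamF_three_inv_sqrt_le {m : ℕ} (hm : 1 ≤ m) :
    ∑ x ∈ lamF 3 m, (√(regSq x))⁻¹ ≤ 27 * (m : ℝ) ^ 2 := by
  have hm' : (1 : ℝ) ≤ m := by exact_mod_cast hm
  have h1 : ∀ x : Zd 3, (√(regSq x))⁻¹ ≤ (m * (regSq x)⁻¹ + (m : ℝ)⁻¹) / 2 := fun x => by
    have h2 : ((√(regSq x))⁻¹) ^ 2 = (regSq x)⁻¹ := by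
      rw [inv_pow, Real.sq_sqrt (regSq_pos x).le]
    rw [← h2]
    have h3 : 0 ≤ ((m : ℝ) * (√(regSq x))⁻¹ - 1) ^ 2 * (m : ℝ)⁻¹ := by positivity
    have h4 : ((m : ℝ) * (√(regSq x))⁻¹ - 1) ^ 2 * (m : ℝ)⁻¹ =
      m * (√(regSq x))⁻¹ ^ 2 + (m : ℝ)⁻¹ - 2 * (√(regSq x))⁻¹ := by field_simp; ring
    linarith
  refine (Finset.sum_le_sum fun x _ => h1 x).trans ?_
  rw [← Finset.sum_div, Finset.sum_add_distrib, ← Finset.mul_sum, Finset.sum_const, card_lamF,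
    nsmul_eq_mul]
  have h5 : ((2 * (m : ℝ) + 1) ^ 3) * (m : ℝ)⁻¹ ≤ 27 * (m : ℝ) ^ 2 := by
    rw [← div_eq_mul_inv, div_le_iff₀ (by positivity)]
    calc (2 * (m : ℝ) + 1) ^ 3 ≤ (3 * m) ^ 3 := by gcongr; linarith
      _ = _ := by ring
  have h6 := mul_le_mul_of_nonneg_left (sum_lamF_three_inv_le m) (by positivity : (0 : ℝ) ≤ m)
  push_cast
  nlinarith

lemma znorm_sq {d : ℕ} (x : Zd d) : znorm x ^ 2 = ∑ i, (x i : ℝ) ^ 2 :=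
  Real.sq_sqrt (Finset.sum_nonneg fun _ _ => sq_nonneg _)

lemma max_znorm_one_sq_le {d : ℕ} (x : Zd d) : max (znorm x) 1 ^ 2 ≤ regSq x := by
  have h := znorm_sq x
  have : 0 ≤ ∑ i, (x i : ℝ) ^ 2 := Finset.sum_nonneg fun _ _ => sq_nonneg _
  unfold regSq
  rcases max_choice (znorm x) 1 with h' | h' <;> rw [h'] <;> linarith

lemma sub_mem_lamF_of_znorm_le {d : ℕ} {x y : Zd d} {r : ℝ} (h : znorm (x - y) ≤ r) :
    x - y ∈ lamF d ⌈r⌉₊ := by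
  rw [mem_lamF]
  intro i
  have h1 : |(((x - y) i : ℤ) : ℝ)| ≤ znorm (x - y) := by
    apply Real.le_sqrt_of_sq_le
    rw [sq_abs]
    exact Finset.single_le_sum (f := fun i => (((x - y) i : ℤ) : ℝ) ^ 2)
      (fun _ _ => sq_nonneg _) (Finset.mem_univ i)
  have h2 : |(((x - y) i : ℤ) : ℝ)| ≤ (⌈r⌉₊ : ℝ) := (h1.trans h).trans (Nat.le_ceil r)
  exact_mod_cast h2

lemma regSq_le_of_znorm_le {d : ℕ} {x y : Zd d} {r : ℝ} (h : znorm (x - y) ≤ r) :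
    regSq x ≤ (2 + 2 * r ^ 2) * regSq y := by
  have h0 : 0 ≤ znorm (x - y) := Real.sqrt_nonneg _
  have h1 := pow_le_pow_left₀ h0 h 2
  rw [znorm_sq] at h1
  have h2 : ∑ i, (x i : ℝ) ^ 2 ≤
      2 * ∑ i, (((x - y) i : ℤ) : ℝ) ^ 2 + 2 * ∑ i, (y i : ℝ) ^ 2 := by
    rw [Finset.mul_sum, Finset.mul_sum, ← Finset.sum_add_distrib]
    refine Finset.sum_le_sum fun i _ => ?_
    simp only [Pi.sub_apply, Int.cast_sub]
    nlinarith [sq_nonneg ((x i : ℝ) - y i - y i)]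
  have h3 := eight_le_regSq y
  have h4 : regSq x ≤ 2 * r ^ 2 + 2 * regSq y := by
    unfold regSq
    linarith
  nlinarith [sq_nonneg r]

lemma measurable_piT {d : ℕ} (x : Zd d) : Measurable fun ρ : Zd d → ℝ => piT ρ x := by
  unfold piT
  fun_prop

lemma measurable_smallTrap {d : ℕ} (R : ℝ) (x : Zd d) :
    Measurable fun ρ : Zd d → ℝ => smallTrap R ρ x := by
  unfold smallTrap
  refine Measurable.ite ?_ measurable_const measurable_const
  exact measurableSet_le (by fun_prop) measurable_const

lemma smallTrap_le_one {d : ℕ} (R : ℝ) (ρ : Zd d → ℝ) (x : Zd d) : smallTrap R ρ x ≤ 1 := by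
  unfold smallTrap
  split_ifs <;> simp

lemma piT_mul_smallTrap_le {d : ℕ} {R : ℝ} (hR : 0 ≤ R) (ρ : Zd d → ℝ) (x : Zd d) :
    piT ρ x * smallTrap R ρ x ≤ ENNReal.ofReal (R * regSq x) := by
  unfold smallTrap piT
  split_ifs with h
  · rw [mul_one]
    exact ENNReal.ofReal_le_ofReal
      (h.trans (mul_le_mul_of_nonneg_left (max_znorm_one_sq_le x) hR))
  · simp

lemma lintegral_piT_eq {d : ℕ} {P : Measure (Zd d → ℝ)}
    (hstat : ∀ z : Zd d, P.map (fun ρ x => ρ (x + z)) = P) (y : Zd d) :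
    ∫⁻ ρ, piT ρ y ∂P = ∫⁻ ρ, piT ρ 0 ∂P := by
  conv_rhs => rw [← hstat y]
  rw [lintegral_map (measurable_piT 0) (by fun_prop)]
  simp [piT]

lemma lintegral_truncated_pair_le {d : ℕ} {P : Measure (Zd d → ℝ)}
    (hstat : ∀ z : Zd d, P.map (fun ρ x => ρ (x + z)) = P)
    (hint : ∫⁻ ρ, piT ρ 0 ∂P < ∞) {R₀ K₀ R : ℝ} (hK₀ : 0 ≤ K₀) (hR : 0 ≤ R)
    (hcorr : ∀ x y : Zd d, R₀ < znorm (x - y) →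
      ∫⁻ ρ, piT ρ x * piT ρ y ∂P ≤ ENNReal.ofReal K₀) (x y : Zd d) :
    ∫⁻ ρ, piT ρ x * piT ρ y * smallTrap R ρ x * smallTrap R ρ y ∂P ≤
      ENNReal.ofReal (K₀ + if znorm (x - y) ≤ R₀ then
        R * (∫⁻ ρ, piT ρ 0 ∂P).toReal * regSq x else 0) := by
  split_ifs with h
  · calc ∫⁻ ρ, piT ρ x * piT ρ y * smallTrap R ρ x * smallTrap R ρ y ∂P
        ≤ ∫⁻ ρ, ENNReal.ofReal (R * regSq x) * piT ρ y ∂P := by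
          refine lintegral_mono fun ρ => ?_
          calc piT ρ x * piT ρ y * smallTrap R ρ x * smallTrap R ρ y
              ≤ piT ρ x * piT ρ y * smallTrap R ρ x * 1 := by
                gcongr
                exact smallTrap_le_one R ρ y
            _ = piT ρ x * smallTrap R ρ x * piT ρ y := by ring
            _ ≤ _ := by
                gcongr
                exact piT_mul_smallTrap_le hR ρ x
      _ = ENNReal.ofReal (R * (∫⁻ ρ, piT ρ 0 ∂P).toReal * regSq x) := by
          rw [lintegral_const_mul _ (measurable_piT y), lintegral_piT_eq hstat,
            mul_right_comm R, ENNReal.ofReal_mul (mul_nonneg hR (regSq_pos x).le),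
            ENNReal.ofReal_toReal hint.ne]
      _ ≤ _ := ENNReal.ofReal_le_ofReal (by linarith)
  · rw [add_zero]
    refine le_trans (lintegral_mono fun ρ => ?_) (hcorr x y (not_le.mp h))
    calc piT ρ x * piT ρ y * smallTrap R ρ x * smallTrap R ρ y
        ≤ piT ρ x * piT ρ y * 1 * 1 := by
          gcongr <;> exact smallTrap_le_one R ρ _
      _ = _ := by ring

lemma sum_mul_shift_le {d : ℕ} {f : Zd d → ℝ} {m : ℕ} {x : Zd d} (hx : x ∈ lamF d m) :
    ∑ y ∈ lamF d m, f (y - x) * f y ≤ ∑ y ∈ lamF d (2 * m), f y ^ 2 := by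
  have h1 : ∑ y ∈ lamF d m, f (y - x) ^ 2 ≤ ∑ y ∈ lamF d (2 * m), f y ^ 2 := by
    rw [← Finset.sum_image (s := lamF d m) (g := fun y => y - x) (f := fun y => f y ^ 2)
      fun a _ b _ h => sub_left_injective h]
    refine Finset.sum_le_sum_of_subset_of_nonneg ?_ fun _ _ _ => sq_nonneg _
    intro z hz
    obtain ⟨y, hy, rfl⟩ := Finset.mem_image.mp hz
    rw [mem_lamF] at *
    intro i
    have := abs_sub (y i) (x i)
    have := hx i
    have := hy i
    simp only [Pi.sub_apply, Nat.cast_mul, Nat.cast_ofNat]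
    linarith
  have h2 : ∑ y ∈ lamF d m, f y ^ 2 ≤ ∑ y ∈ lamF d (2 * m), f y ^ 2 :=
    Finset.sum_le_sum_of_subset_of_nonneg (lamF_mono (by omega)) fun _ _ _ => sq_nonneg _
  have h3 : ∑ y ∈ lamF d m, f (y - x) * f y ≤
      ∑ y ∈ lamF d m, (f (y - x) ^ 2 + f y ^ 2) / 2 :=
    Finset.sum_le_sum fun y _ => by nlinarith [sq_nonneg (f (y - x) - f y)]
  rw [← Finset.sum_div, Finset.sum_add_distrib] at h3
  linarith

lemma sum_near_le {d : ℕ} {f : Zd d → ℝ} (hf0 : ∀ x, 0 ≤ f x) (hf1 : ∀ x, f x ≤ 1)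
    (hfD : ∀ D : ℝ, 1 ≤ D → ∀ x y, regSq x ≤ D * regSq y → f y ≤ D * f x)
    (r : ℝ) (s : Finset (Zd d)) (x : Zd d) :
    ∑ y ∈ s with znorm (x - y) ≤ r, f (y - x) * f y ≤
      ((lamF d ⌈r⌉₊).card : ℝ) * ((2 + 2 * r ^ 2) * f x) := by
  have hD : 0 ≤ (2 + 2 * r ^ 2) * f x := mul_nonneg (by positivity) (hf0 x)
  calc ∑ y ∈ s with znorm (x - y) ≤ r, f (y - x) * f y
      ≤ ∑ y ∈ s with znorm (x - y) ≤ r, (2 + 2 * r ^ 2) * f x := by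
        refine Finset.sum_le_sum fun y hy => ?_
        have h := (Finset.mem_filter.mp hy).2
        have h1 := hfD (2 + 2 * r ^ 2) (by nlinarith [sq_nonneg r]) x y (regSq_le_of_znorm_le h)
        exact (mul_le_of_le_one_left (hf0 y) (hf1 _)).trans h1
    _ ≤ _ := by
        rw [Finset.sum_const, nsmul_eq_mul]
        refine mul_le_mul_of_nonneg_right ?_ hD
        rw [Nat.cast_le]
        refine Finset.card_le_card_of_injOn (fun y => x - y)
          (fun y hy => sub_mem_lamF_of_znorm_le (Finset.mem_filter.mp hy).2)
          fun a _ b _ h => sub_right_injective h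

lemma sum_sum_green_le {d : ℕ} {f : Zd d → ℝ} (hf0 : ∀ x, 0 ≤ f x) (hf1 : ∀ x, f x ≤ 1)
    (hfD : ∀ D : ℝ, 1 ≤ D → ∀ x y, regSq x ≤ D * regSq y → f y ≤ D * f x)
    {K M : ℝ} (hK : 0 ≤ K) (hM : 0 ≤ M) (r : ℝ) (m : ℕ) :
    ∑ x ∈ lamF d m, ∑ y ∈ lamF d m, f x ^ 2 * f (y - x) * f y *
        (K + if znorm (x - y) ≤ r then M * regSq x else 0) ≤
      K * ((∑ x ∈ lamF d m, f x ^ 2) * ∑ x ∈ lamF d (2 * m), f x ^ 2) +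
      M * ((lamF d ⌈r⌉₊).card * (2 + 2 * r ^ 2)) * ∑ x ∈ lamF d m, f x ^ 3 * regSq x := by
  rw [Finset.sum_mul, Finset.mul_sum, Finset.mul_sum, ← Finset.sum_add_distrib]
  refine Finset.sum_le_sum fun x hx => ?_
  have h1 : ∑ y ∈ lamF d m, f x ^ 2 * f (y - x) * f y *
        (K + if znorm (x - y) ≤ r then M * regSq x else 0) =
      K * f x ^ 2 * ∑ y ∈ lamF d m, f (y - x) * f y +
      M * regSq x * f x ^ 2 * ∑ y ∈ lamF d m with znorm (x - y) ≤ r, f (y - x) * f y := by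
    rw [Finset.sum_filter, Finset.mul_sum, Finset.mul_sum, ← Finset.sum_add_distrib]
    refine Finset.sum_congr rfl fun y _ => ?_
    split_ifs <;> ring
  rw [h1]
  have hA := (regSq_pos x).le
  have h2 := mul_le_mul_of_nonneg_left (sum_mul_shift_le (f := f) hx)
    (by positivity : 0 ≤ K * f x ^ 2)
  have h3 := mul_le_mul_of_nonneg_left (sum_near_le hf0 hf1 hfD r (lamF d m) x)
    (by positivity : 0 ≤ M * regSq x * f x ^ 2)
  refine (add_le_add h2 h3).trans_eq ?_
  ring

/-- Reduction of the expectation bound to two lattice sums, for any Green's function majorant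
`f` that is comparable at comparable distances from the origin. -/
lemma exists_lintegral_green_le {d : ℕ} {P : Measure (Zd d → ℝ)}
    (hstat : ∀ z : Zd d, P.map (fun ρ x => ρ (x + z)) = P)
    (hint : ∫⁻ ρ, piT ρ 0 ∂P < ∞)
    (hcorr : ∃ R₀ K₀ : ℝ, 0 < R₀ ∧ 0 < K₀ ∧ ∀ x y : Zd d, R₀ < znorm (x - y) →
      ∫⁻ ρ, piT ρ x * piT ρ y ∂P ≤ ENNReal.ofReal K₀)
    {f : Zd d → ℝ} (hf0 : ∀ x, 0 ≤ f x) (hf1 : ∀ x, f x ≤ 1)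
    (hfD : ∀ D : ℝ, 1 ≤ D → ∀ x y, regSq x ≤ D * regSq y → f y ≤ D * f x)
    {C : ℝ} (hC : 0 ≤ C) (hg : ∀ x y, gSRW d x y ≤ ENNReal.ofReal (C * f (y - x)))
    {R : ℝ} (hR : 0 < R) :
    ∃ c : ℝ, 0 < c ∧ ∀ m : ℕ,
      ∫⁻ ρ, ∑ x ∈ lamF d m, ∑ y ∈ lamF d m,
          gSRW d 0 x ^ 2 * gSRW d x y * gSRW d 0 y * piT ρ x * piT ρ y *
            smallTrap R ρ x * smallTrap R ρ y ∂P ≤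
        ENNReal.ofReal (c * ((∑ x ∈ lamF d m, f x ^ 2) * (∑ x ∈ lamF d (2 * m), f x ^ 2) +
          ∑ x ∈ lamF d m, f x ^ 3 * regSq x)) := by
  obtain ⟨R₀, K₀, -, hK₀, hcorr⟩ := hcorr
  set M : ℝ := R * (∫⁻ ρ, piT ρ 0 ∂P).toReal with hMdef
  have hM : 0 ≤ M := by positivity
  set L : ℝ := M * ((lamF d ⌈R₀⌉₊).card * (2 + 2 * R₀ ^ 2)) with hL
  have hL0 : 0 ≤ L := by positivity
  refine ⟨C ^ 4 * (K₀ + L) + 1, by positivity, fun m => ?_⟩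
  have hterm : ∀ x y : Zd d, ∫⁻ ρ, gSRW d 0 x ^ 2 * gSRW d x y * gSRW d 0 y * piT ρ x *
      piT ρ y * smallTrap R ρ x * smallTrap R ρ y ∂P ≤
      ENNReal.ofReal (C ^ 4 * (f x ^ 2 * f (y - x) * f y *
        (K₀ + if znorm (x - y) ≤ R₀ then M * regSq x else 0))) := by
    intro x y
    have hm : Measurable fun ρ : Zd d → ℝ =>
        piT ρ x * piT ρ y * smallTrap R ρ x * smallTrap R ρ y :=
      (((measurable_piT x).mul (measurable_piT y)).mul (measurable_smallTrap R x)).mul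
        (measurable_smallTrap R y)
    have h0x := hg 0 x
    have h0y := hg 0 y
    rw [sub_zero] at h0x h0y
    calc _ = (gSRW d 0 x ^ 2 * gSRW d x y * gSRW d 0 y) *
          ∫⁻ ρ, piT ρ x * piT ρ y * smallTrap R ρ x * smallTrap R ρ y ∂P := by
          rw [← lintegral_const_mul _ hm]
          simp only [mul_assoc]
      _ ≤ (ENNReal.ofReal (C * f x) ^ 2 * ENNReal.ofReal (C * f (y - x)) *
            ENNReal.ofReal (C * f y)) *
          ENNReal.ofReal (K₀ + if znorm (x - y) ≤ R₀ then M * regSq x else 0) := by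
          gcongr
          · exact hg x y
          · exact lintegral_truncated_pair_le hstat hint hK₀.le hR.le hcorr x y
      _ = _ := by
          have hx := mul_nonneg hC (hf0 x)
          have hy := mul_nonneg hC (hf0 y)
          have hxy := mul_nonneg hC (hf0 (y - x))
          rw [← ENNReal.ofReal_pow hx, ← ENNReal.ofReal_mul (by positivity),
            ← ENNReal.ofReal_mul (by positivity), ← ENNReal.ofReal_mul (by positivity)]
          congr 1
          ring
  have hmeas : ∀ x y : Zd d, Measurable fun ρ : Zd d → ℝ =>
      gSRW d 0 x ^ 2 * gSRW d x y * gSRW d 0 y * piT ρ x *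
        piT ρ y * smallTrap R ρ x * smallTrap R ρ y := fun x y =>
    ((((measurable_piT x).const_mul _).mul (measurable_piT y)).mul
      (measurable_smallTrap R x)).mul (measurable_smallTrap R y)
  have hnn : ∀ x y : Zd d, 0 ≤ C ^ 4 * (f x ^ 2 * f (y - x) * f y *
      (K₀ + if znorm (x - y) ≤ R₀ then M * regSq x else 0)) := fun x y => by
    have hx := hf0 x
    have hy := hf0 y
    have hxy := hf0 (y - x)
    have hA := (regSq_pos x).le
    split_ifs <;> positivity
  rw [lintegral_finsetSum _ fun x _ => Finset.measurable_sum _ fun y _ => hmeas x y]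
  simp_rw [lintegral_finsetSum _ fun y _ => hmeas _ y]
  refine (Finset.sum_le_sum fun x _ => Finset.sum_le_sum fun y _ => hterm x y).trans ?_
  simp_rw [← ENNReal.ofReal_sum_of_nonneg fun y _ => hnn _ y]
  rw [← ENNReal.ofReal_sum_of_nonneg fun x _ => Finset.sum_nonneg fun y _ => hnn x y]
  refine ENNReal.ofReal_le_ofReal ?_
  simp_rw [← Finset.mul_sum]
  have hS : 0 ≤ (∑ x ∈ lamF d m, f x ^ 2) * ∑ x ∈ lamF d (2 * m), f x ^ 2 :=
    mul_nonneg (Finset.sum_nonneg fun _ _ => sq_nonneg _)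
      (Finset.sum_nonneg fun _ _ => sq_nonneg _)
  have hT : 0 ≤ ∑ x ∈ lamF d m, f x ^ 3 * regSq x :=
    Finset.sum_nonneg fun x _ => mul_nonneg (pow_nonneg (hf0 x) 3) (regSq_pos x).le
  have h := mul_le_mul_of_nonneg_left (sum_sum_green_le hf0 hf1 hfD hK₀.le hM R₀ m)
    (by positivity : 0 ≤ C ^ 4)
  rw [← hL] at h
  refine h.trans ?_
  have e1 := mul_nonneg (mul_nonneg (pow_nonneg hC 4) hL0) hS
  have e2 := mul_nonneg (mul_nonneg (pow_nonneg hC 4) hK₀.le) hT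
  nlinarith

lemma inv_le_mul_inv {a b D : ℝ} (ha : 0 < a) (hb : 0 < b) (h : a ≤ D * b) :
    b⁻¹ ≤ D * a⁻¹ := by
  rw [← div_eq_mul_inv, le_div_iff₀ ha, inv_mul_le_iff₀ hb]
  linarith

lemma harmonic_le_mul_log {m : ℕ} (hm : 2 ≤ m) : (harmonic m : ℝ) ≤ 3 * Real.log m := by
  have h1 := harmonic_le_one_add_log m
  have h2 : Real.log 2 ≤ Real.log m :=
    Real.log_le_log (by norm_num) (by exact_mod_cast hm)
  linarith [Real.log_two_gt_d9]

lemma sum_lamF_four_inv_sq_le_log {m : ℕ} (hm : 2 ≤ m) :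
    ∑ x ∈ lamF 4 m, ((regSq x) ^ 2)⁻¹ ≤ 242 * Real.log m := by
  have h1 := sum_lamF_four_inv_sq_le m
  have h2 := harmonic_le_mul_log hm
  have h3 : Real.log 2 ≤ Real.log m :=
    Real.log_le_log (by norm_num) (by exact_mod_cast hm)
  linarith [Real.log_two_gt_d9]

theorem stmt12 (d : ℕ) (hd : d = 3 ∨ d = 4) (P : Measure (Zd d → ℝ))
    [IsProbabilityMeasure P]
    (hrange : ∀ᵐ ρ ∂P, ∀ x, ρ x ∈ Set.Ico (0 : ℝ) 1)
    (hstat : ∀ z : Zd d, P.map (fun ρ x => ρ (x + z)) = P)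
    (hint : ∫⁻ ρ, piT ρ 0 ∂P < ∞)
    (hcorr : ∃ R₀ K₀ : ℝ, 0 < R₀ ∧ 0 < K₀ ∧ ∀ x y : Zd d, R₀ < znorm (x - y) →
      ∫⁻ ρ, piT ρ x * piT ρ y ∂P ≤ ENNReal.ofReal K₀) :
    ∀ R : ℝ, 0 < R → ∃ c : ℝ, 0 < c ∧ ∀ m : ℕ, 2 ≤ m →
      (d = 3 →
        ∫⁻ ρ, ∑ x ∈ lamF d m, ∑ y ∈ lamF d m,
            gSRW d 0 x ^ 2 * gSRW d x y * gSRW d 0 y * piT ρ x * piT ρ y *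
              smallTrap R ρ x * smallTrap R ρ y ∂P
          ≤ ENNReal.ofReal (c * m ^ 2)) ∧
      (d = 4 →
        ∫⁻ ρ, ∑ x ∈ lamF d m, ∑ y ∈ lamF d m,
            gSRW d 0 x ^ 2 * gSRW d x y * gSRW d 0 y * piT ρ x * piT ρ y *
              smallTrap R ρ x * smallTrap R ρ y ∂P
          ≤ ENNReal.ofReal (c * Real.log m ^ 2)) := by
  intro R hR
  rcases hd with rfl | rfl
  · obtain ⟨c, hc, h⟩ := exists_lintegral_green_le hstat hint hcorr
      (f := fun x => (√(regSq x))⁻¹) (fun x => by positivity)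
      (fun x => inv_le_one_of_one_le₀ (by
        rw [Real.one_le_sqrt]; linarith [eight_le_regSq x]))
      (fun D hD x y hxy => by
        refine inv_le_mul_inv (Real.sqrt_pos.mpr (regSq_pos x)) (Real.sqrt_pos.mpr (regSq_pos y)) ?_
        refine (Real.sqrt_le_sqrt hxy).trans ?_
        rw [Real.sqrt_mul (by linarith)]
        gcongr
        rw [Real.sqrt_le_left (by linarith)]
        nlinarith)
      (C := 72) (by norm_num) gSRW_three_le hR
    refine ⟨c * 1458, by positivity, fun m hm => ⟨fun _ => ?_, fun h4 => by omega⟩⟩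
    refine (h m).trans (ENNReal.ofReal_le_ofReal ?_)
    have hm' : (2 : ℝ) ≤ m := by exact_mod_cast hm
    have hS : ∀ n : ℕ, ∑ x ∈ lamF 3 n, ((√(regSq x))⁻¹) ^ 2 ≤ 1 + 26 * n := fun n => by
      refine le_of_eq_of_le (Finset.sum_congr rfl fun x _ => ?_) (sum_lamF_three_inv_le n)
      rw [inv_pow, Real.sq_sqrt (regSq_pos x).le]
    have hT : ∑ x ∈ lamF 3 m, ((√(regSq x))⁻¹) ^ 3 * regSq x ≤ 27 * (m : ℝ) ^ 2 := by
      refine le_of_eq_of_le (Finset.sum_congr rfl fun x _ => ?_)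
        (sum_lamF_three_inv_sqrt_le (by omega : 1 ≤ m))
      have hs := Real.sq_sqrt (regSq_pos x).le
      have hp := Real.sqrt_pos.mpr (regSq_pos x)
      nth_rw 2 [← hs]
      field_simp
    rw [mul_assoc]
    gcongr
    have h1 : ∑ x ∈ lamF 3 m, ((√(regSq x))⁻¹) ^ 2 ≤ 27 * m := (hS m).trans (by linarith)
    have h2 : ∑ x ∈ lamF 3 (2 * m), ((√(regSq x))⁻¹) ^ 2 ≤ 53 * m :=
      (hS (2 * m)).trans (by push_cast; linarith)
    have h3 := mul_le_mul h1 h2 (Finset.sum_nonneg fun _ _ => sq_nonneg _) (by positivity)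
    nlinarith
  · obtain ⟨c, hc, h⟩ := exists_lintegral_green_le hstat hint hcorr
      (f := fun x => (regSq x)⁻¹) (fun x => (inv_pos.mpr (regSq_pos x)).le)
      (fun x => inv_le_one_of_one_le₀ (by linarith [eight_le_regSq x]))
      (fun D hD x y hxy => inv_le_mul_inv (regSq_pos x) (regSq_pos y) hxy)
      (C := 72) (by norm_num) gSRW_four_le hR
    refine ⟨c * (242 * 484 + 484), by positivity, fun m hm => ⟨fun h3 => by omega, fun _ => ?_⟩⟩
    refine (h m).trans (ENNReal.ofReal_le_ofReal ?_)
    have hm' : (2 : ℝ) ≤ m := by exact_mod_cast hm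
    have hlog : Real.log 2 ≤ Real.log m := Real.log_le_log (by norm_num) hm'
    have hlog2 := Real.log_two_gt_d9
    have h1 := sum_lamF_four_inv_sq_le_log hm
    have h2 : ∑ x ∈ lamF 4 (2 * m), ((regSq x) ^ 2)⁻¹ ≤ 484 * Real.log m := by
      refine (sum_lamF_four_inv_sq_le_log (by omega : 2 ≤ 2 * m)).trans ?_
      push_cast
      rw [Real.log_mul (by norm_num) (by positivity)]
      linarith
    have hT : ∑ x ∈ lamF 4 m, ((regSq x)⁻¹) ^ 3 * regSq x ≤ 242 * Real.log m := by
      refine le_of_eq_of_le (Finset.sum_congr rfl fun x _ => ?_) h1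
      have hp := regSq_pos x
      field_simp
    simp only [inv_pow] at hT ⊢
    rw [mul_assoc]
    gcongr
    have h3 := mul_le_mul h1 h2
      (Finset.sum_nonneg fun x _ => (inv_pos.mpr (pow_pos (regSq_pos x) 2)).le)
      (mul_nonneg (by norm_num) (by linarith))
    nlinarith
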